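/- Let f : ℝ → ℝ be continuous with f(0) = 0, f₀ := lim_{s→0} f(s)/s existing, finite and positive, and f_∞ = f_{-∞} = ∞ (i.e., f(s)/s → ∞ as |s| → ∞), and s·f(s) > 0 for s ≠ 0. Consider the Dirichlet problem -u'' = f(u) on (-1,1), u(±1) = 0, with Dirichlet eigenvalues λ_k = (kπ/2)². If λ_{k₀}/f₀ > 1 for some k₀ ≥ 1, then for each k ≥ k₀ the problem has a solution u with exactly k interior critical points, all simple, and a zero strictly between each consecutive pair of critical points, for each sign of u'(-1). -/

import Mathlib

open Real Filter

/-- Nodal property: the sets T_{k,ν}: u'(±1) ≠ 0, sign of u'(-1) given by ν,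
exactly k simple interior zeros of u', and a zero of u strictly between each
pair of consecutive zeros of u'. -/
def NodalT (k : ℕ) (pos : Bool) (u u' : ℝ → ℝ) : Prop :=
  u' (-1) ≠ 0 ∧ u' 1 ≠ 0 ∧
  (if pos then 0 < u' (-1) else u' (-1) < 0) ∧
  ∃ Z : Finset ℝ,
    Z.card = k ∧ (↑Z : Set ℝ) ⊆ Set.Ioo (-1) 1 ∧
    (∀ x ∈ Set.Ioo (-1 : ℝ) 1, (u' x = 0 ↔ x ∈ Z)) ∧
    (∀ x ∈ Z, deriv u' x ≠ 0) ∧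
    (∀ x ∈ Z, ∀ y ∈ Z, x < y → (∀ z ∈ Z, z ≤ x ∨ y ≤ z) →
      ∃ w ∈ Set.Ioo x y, u w = 0)

/-- Inverse function with linear growth bounds. -/
lemma exists_inv (H H' : ℝ → ℝ) (hd : ∀ x, HasDerivAt H (H' x) x) (hpos : ∀ x, 0 < H' x)
    (c : ℝ) (hc : 0 < c) (h1 : ∀ x, 0 ≤ x → c * x ≤ H x) (h2 : ∀ x, x ≤ 0 → H x ≤ c * x) :
    ∃ G : ℝ → ℝ, (∀ w, H (G w) = w) ∧ (∀ s, G (H s) = s) ∧ StrictMono G ∧ Continuous G ∧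
      ∀ w, HasDerivAt G (H' (G w))⁻¹ w := by
  have hm : StrictMono H := strictMono_of_hasDerivAt_pos hd hpos
  have hcont : Continuous H := continuous_iff_continuousAt.2 fun x => (hd x).continuousAt
  have ht : Tendsto H atTop atTop := by
    refine tendsto_atTop_mono' _ ?_ (tendsto_id.const_mul_atTop hc)
    filter_upwards [eventually_ge_atTop 0] with x hx using h1 x hx
  have hb : Tendsto H atBot atBot := by
    refine tendsto_atBot_mono' _ ?_ (tendsto_id.const_mul_atBot hc)
    filter_upwards [eventually_le_atBot 0] with x hx using h2 x hx
  have hs : Function.Surjective H := hcont.surjective ht hb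
  let e := hm.orderIsoOfSurjective H hs
  have he : ∀ w, H (e.symm w) = w := fun w => e.apply_symm_apply w
  refine ⟨e.symm, he, fun s => e.symm_apply_apply s, e.symm.strictMono, e.symm.continuous, ?_⟩
  intro w
  exact HasDerivAt.of_local_left_inverse e.symm.continuous.continuousAt (hd _) (hpos _).ne'
    (Eventually.of_forall he)

/-- The change of variables that turns the equation into a rotation. -/
lemma exists_change (f : ℝ → ℝ) (hf : Continuous f) (hf0 : f 0 = 0)
    (f₀ : ℝ) (hf₀pos : 0 < f₀)
    (hlim0 : Tendsto (fun s => f s / s) (nhdsWithin 0 {(0 : ℝ)}ᶜ) (nhds f₀))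
    (hlimP : Tendsto (fun s => f s / s) atTop atTop)
    (hlimM : Tendsto (fun s => f s / s) atBot atTop)
    (hsf : ∀ s : ℝ, s ≠ 0 → 0 < s * f s) :
    ∃ G p : ℝ → ℝ, Continuous p ∧ (∀ w, 0 < p w) ∧ (∀ w, HasDerivAt G (p w) w) ∧ G 0 = 0 ∧
      (∀ w, p w * f (G w) = w) ∧ p 0 = (√f₀)⁻¹ ∧ Function.Surjective G := by
  classical
  let g : ℝ → ℝ := Function.update (fun s => f s / s) 0 f₀
  have g0 : g 0 = f₀ := Function.update_self ..
  have gne : ∀ s, s ≠ 0 → g s = f s / s := fun s hs => Function.update_of_ne hs ..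
  have fg : ∀ s, f s = s * g s := by
    intro s
    rcases eq_or_ne s 0 with rfl | hs
    · simp [hf0]
    · rw [gne s hs]; field_simp
  have gc : Continuous g := by
    rw [continuous_iff_continuousAt]
    intro s
    rcases eq_or_ne s 0 with rfl | hs
    · exact continuousAt_update_same.2 hlim0
    · rw [continuousAt_update_of_ne hs]
      exact hf.continuousAt.div continuousAt_id hs
  have gpos : ∀ s, 0 < g s := by
    intro s
    rcases eq_or_ne s 0 with rfl | hs
    · rw [g0]; exact hf₀pos
    · rw [gne s hs]
      have := hsf s hs
      have h2 : f s / s = (s * f s) / s ^ 2 := by field_simp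
      rw [h2]; positivity
  have gt : Tendsto g (cocompact ℝ) atTop := by
    rw [cocompact_eq_atBot_atTop, tendsto_sup]
    constructor
    · refine hlimM.congr' ?_
      filter_upwards [eventually_lt_atBot 0] with s hs using (gne s hs.ne).symm
    · refine hlimP.congr' ?_
      filter_upwards [eventually_gt_atTop 0] with s hs using (gne s hs.ne').symm
  obtain ⟨s0, hs0⟩ := gc.exists_forall_le gt
  set m := g s0 with hm
  have mpos : 0 < m := gpos s0
  let Q : ℝ → ℝ := fun s => ∫ τ in (0:ℝ)..1, τ * g (s * τ)
  have Qc : Continuous Q := by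
    apply intervalIntegral.continuous_parametric_intervalIntegral_of_continuous'
    fun_prop
  have Q0 : Q 0 = f₀ / 2 := by
    simp only [Q, zero_mul, g0]
    rw [intervalIntegral.integral_mul_const, integral_id]; ring
  have Qge : ∀ s, m / 2 ≤ Q s := by
    intro s
    have : m / 2 = ∫ τ in (0:ℝ)..1, τ * m := by
      rw [intervalIntegral.integral_mul_const, integral_id]; ring
    rw [this]
    apply intervalIntegral.integral_mono_on zero_le_one
    · exact (by fun_prop : Continuous fun τ : ℝ => τ * m).intervalIntegrable _ _
    · exact (by fun_prop : Continuous fun τ : ℝ => τ * g (s * τ)).intervalIntegrable _ _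
    · intro x hx
      exact mul_le_mul_of_nonneg_left (hs0 _) hx.1
  have FQ : ∀ s, ∫ x in (0:ℝ)..s, f x = s ^ 2 * Q s := by
    intro s
    have h := intervalIntegral.mul_integral_comp_mul_left (a := 0) (b := 1) (f := f) s
    rw [mul_zero, mul_one] at h
    rw [← h, pow_two, mul_assoc]
    congr 1
    simp only [Q]
    rw [← intervalIntegral.integral_const_mul]
    congr 1
    ext x
    rw [fg]; ring
  let F : ℝ → ℝ := fun s => ∫ x in (0:ℝ)..s, f x
  have Fd : ∀ s, HasDerivAt F (f s) s := fun s => hf.integral_hasStrictDerivAt 0 s |>.hasDerivAt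
  let q : ℝ → ℝ := fun s => √(2 * Q s)
  have qc : Continuous q := by fun_prop
  have qge : ∀ s, √m ≤ q s := fun s => Real.sqrt_le_sqrt (by linarith [Qge s])
  have smpos : 0 < √m := Real.sqrt_pos.2 mpos
  have qpos : ∀ s, 0 < q s := fun s => smpos.trans_le (qge s)
  have q0 : q 0 = √f₀ := by simp only [q, Q0]; congr 1; ring
  have sqF : ∀ s, √(2 * F s) = |s| * q s := by
    intro s
    simp only [F, FQ, q]
    rw [show 2 * (s ^ 2 * Q s) = s ^ 2 * (2 * Q s) by ring, Real.sqrt_mul (sq_nonneg s),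
      Real.sqrt_sq_eq_abs]
  have Fne : ∀ s, s ≠ 0 → 2 * F s ≠ 0 := by
    intro s hs
    simp only [F, FQ]
    have := Qge s
    have : 0 < Q s := by linarith
    positivity
  let h : ℝ → ℝ := fun s => s * q s
  have hd : ∀ s, HasDerivAt h (g s / q s) s := by
    intro s
    rcases lt_trichotomy s 0 with hs | rfl | hs
    · have := (((Fd s).const_mul 2).sqrt (Fne s hs.ne)).neg
      rw [sqF, abs_of_neg hs, fg] at this
      have e : -(2 * (s * g s) / (2 * (-s * q s))) = g s / q s := by
        have := (qpos s).ne'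
        have := hs.ne
        field_simp
      rw [e] at this
      refine this.congr_of_eventuallyEq ?_
      filter_upwards [eventually_lt_nhds hs] with x hx
      simp only [Pi.neg_apply, h]
      rw [sqF, abs_of_neg hx]; ring
    · rw [hasDerivAt_iff_tendsto_slope, g0, q0]
      have e : f₀ / √f₀ = q 0 := by rw [q0]; exact Real.div_sqrt
      rw [e]
      refine (qc.tendsto 0 |>.mono_left nhdsWithin_le_nhds).congr' ?_
      filter_upwards [self_mem_nhdsWithin] with x hx
      have hx : x ≠ 0 := hx
      simp [slope_def_field, h]
      field_simp
    · have := (((Fd s).const_mul 2).sqrt (Fne s hs.ne'))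
      rw [sqF, abs_of_pos hs, fg] at this
      have e : (2 * (s * g s) / (2 * (s * q s))) = g s / q s := by
        have := (qpos s).ne'
        have := hs.ne'
        field_simp
      rw [e] at this
      refine this.congr_of_eventuallyEq ?_
      filter_upwards [eventually_gt_nhds hs] with x hx
      simp only [h]
      rw [sqF, abs_of_pos hx]
  obtain ⟨G, hG1, hG2, -, hGc, hGd⟩ := exists_inv h (fun s => g s / q s) hd
    (fun s => div_pos (gpos s) (qpos s)) (√m) smpos
    (fun x hx => by
      have := mul_le_mul_of_nonneg_left (qge x) hx
      simp only [h]; linarith)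
    (fun x hx => by
      have := mul_le_mul_of_nonpos_left (qge x) hx
      simp only [h]; linarith)
  have hG0 : G 0 = 0 := by
    have := hG2 0
    simpa [h] using this
  refine ⟨G, fun w => (g (G w) / q (G w))⁻¹, ?_, ?_, hGd, hG0, ?_, ?_, fun s => ⟨h s, hG2 s⟩⟩
  · exact ((gc.comp hGc).div (qc.comp hGc) (fun w => (qpos _).ne')).inv₀
      (fun w => (div_pos (gpos _) (qpos _)).ne')
  · exact fun w => inv_pos.2 (div_pos (gpos _) (qpos _))
  · intro w
    have := hG1 w
    simp only [h] at this
    have h1 := (gpos (G w)).ne'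
    have h2 := (qpos (G w)).ne'
    show (g (G w) / q (G w))⁻¹ * f (G w) = w
    rw [fg, inv_div]
    refine Eq.trans ?_ this
    field_simp
  · simp only [hG0, g0, q0]
    rw [Real.div_sqrt]

/-- Half-wave length tends to zero for large amplitude. -/
lemma half_wave (f G p : ℝ → ℝ) (hp : Continuous p) (hpp : ∀ w, 0 < p w)
    (hG : ∀ w, HasDerivAt G (p w) w) (hG0 : G 0 = 0) (hfG : ∀ w, p w * f (G w) = w)
    (hsurj : Function.Surjective G)
    (hlimP : Tendsto (fun s => f s / s) atTop atTop) (ε : ℝ) (hε : 0 < ε) :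
    ∀ᶠ r in atTop, ∫ φ in (0:ℝ)..π, p (r * sin φ) ≤ ε := by
  have Gm : StrictMono G := strictMono_of_hasDerivAt_pos hG hpp
  set m : ℝ := 2 * π / ε with hm
  have mpos : 0 < m := by positivity
  obtain ⟨R, hR1, hR⟩ : ∃ R : ℝ, 0 < R ∧ ∀ s, R ≤ s → m ^ 2 * s ≤ f s := by
    have := (hlimP.eventually_ge_atTop (m ^ 2)).and (eventually_gt_atTop 0)
    obtain ⟨R, hR⟩ := eventually_atTop.1 this
    refine ⟨max R 1, by positivity, fun s hs => ?_⟩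
    have := hR s (le_trans (le_max_left _ _) hs)
    exact (le_div_iff₀ this.2).1 this.1
  obtain ⟨w0, hw0⟩ := hsurj R
  have w0pos : 0 < w0 := by
    rw [← Gm.lt_iff_lt, hw0, hG0]; exact hR1
  filter_upwards [eventually_ge_atTop (2 * w0), eventually_ge_atTop (8 * R / ε)] with r hr1 hr2
  have rpos : 0 < r := by linarith
  have Ac : Continuous fun φ : ℝ => p (r * sin φ) := by fun_prop
  let A : ℝ → ℝ := fun θ => ∫ φ in (0:ℝ)..θ, p (r * sin φ)
  have Ad : ∀ θ, HasDerivAt A (p (r * sin θ)) θ := fun θ =>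
    (Ac.integral_hasStrictDerivAt 0 θ).hasDerivAt
  have sym : ∫ φ in (0:ℝ)..π, p (r * sin φ) = 2 * A (π / 2) := by
    have h1 := intervalIntegral.integral_add_adjacent_intervals
      (Ac.intervalIntegrable 0 (π / 2)) (Ac.intervalIntegrable (π / 2) π) (μ := MeasureTheory.volume)
    have h2 := intervalIntegral.integral_comp_sub_left (a := 0) (b := π / 2)
      (fun φ : ℝ => p (r * sin φ)) π
    simp only [sin_pi_sub] at h2
    rw [sub_zero, show π - π / 2 = π / 2 by ring] at h2
    rw [← h1, ← h2]; simp only [A]; ring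
  let θ1 := arcsin (w0 / r)
  have hq : w0 / r ≤ 1 / 2 := by rw [div_le_div_iff₀ rpos two_pos]; linarith
  have hq0 : 0 < w0 / r := by positivity
  have θ1pos : 0 < θ1 := arcsin_pos.2 hq0
  have sinθ1 : sin θ1 = w0 / r := sin_arcsin (by linarith) (by linarith)
  have θ1le : θ1 ≤ π / 6 := by
    have : θ1 ≤ arcsin (1 / 2) := monotone_arcsin hq
    rwa [← sin_pi_div_six, arcsin_sin (by linarith [pi_pos]) (by linarith [pi_pos])] at this
  have rs : r * sin θ1 = w0 := by rw [sinθ1]; field_simp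
  have Gd : ∀ θ, HasDerivAt (fun θ => G (r * sin θ)) (p (r * sin θ) * (r * cos θ)) θ := fun θ =>
    (hG (r * sin θ)).comp θ ((hasDerivAt_sin θ).const_mul r)
  have part1 : A θ1 ≤ 2 * R / r := by
    have mono : MonotoneOn (fun θ => 2 / r * G (r * sin θ) - A θ) (Set.Icc 0 θ1) := by
      have D : ∀ θ, HasDerivAt (fun θ => 2 / r * G (r * sin θ) - A θ)
        (2 / r * (p (r * sin θ) * (r * cos θ)) - p (r * sin θ)) θ := fun θ =>
        ((Gd θ).const_mul (2 / r)).sub (Ad θ)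
      refine monotoneOn_of_hasDerivWithinAt_nonneg (convex_Icc _ _)
        (fun x _ => (D x).continuousAt.continuousWithinAt) (fun x _ => (D x).hasDerivWithinAt) ?_
      intro x hx
      rw [interior_Icc] at hx
      have hcos : 1 / 2 ≤ cos x := by
        rw [← cos_pi_div_three]
        exact cos_le_cos_of_nonneg_of_le_pi hx.1.le (by linarith [pi_pos])
          (by linarith [hx.2, pi_pos])
      have := hpp (r * sin x)
      have e : 2 / r * (p (r * sin x) * (r * cos x)) - p (r * sin x)
        = p (r * sin x) * (2 * cos x - 1) := by field_simp
      rw [e]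
      exact mul_nonneg this.le (by linarith)
    have := mono (Set.left_mem_Icc.2 θ1pos.le) (Set.right_mem_Icc.2 θ1pos.le) θ1pos.le
    simp only [sin_zero, mul_zero, hG0, rs, hw0] at this
    have A0 : A 0 = 0 := by simp [A]
    rw [A0] at this
    have e : 2 / r * R = 2 * R / r := by ring
    linarith
  have part2 : A (π / 2) - A θ1 ≤ π / 2 / m := by
    have hle : θ1 ≤ π / 2 := by linarith [pi_pos]
    have Gge : ∀ x ∈ Set.Icc θ1 (π / 2), R ≤ G (r * sin x) := by
      intro x hx
      rw [← hw0, Gm.le_iff_le, ← rs]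
      exact mul_le_mul_of_nonneg_left
        (sin_le_sin_of_le_of_le_pi_div_two (by linarith [pi_pos]) hx.2 hx.1) rpos.le
    let y : ℝ → ℝ := fun θ => r * cos θ / (m * G (r * sin θ))
    let B : ℝ → ℝ := fun θ => - (1 / m) * arctan (y θ)
    have mono : MonotoneOn (fun θ => B θ - A θ) (Set.Icc θ1 (π / 2)) := by
      have D : ∀ θ ∈ Set.Icc θ1 (π / 2), HasDerivAt (fun θ => B θ - A θ)
        (-(1 / m) * (1 / (1 + (y θ) ^ 2) * ((r * (- sin θ) * (m * G (r * sin θ))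
          - r * cos θ * (m * (p (r * sin θ) * (r * cos θ)))) / (m * G (r * sin θ)) ^ 2))
          - p (r * sin θ)) θ := by
        intro θ hθ
        have hGp := Gge θ hθ
        have : m * G (r * sin θ) ≠ 0 := (mul_pos mpos (by linarith)).ne'
        exact (((((hasDerivAt_cos θ).const_mul r).div ((Gd θ).const_mul m) this).arctan).const_mul
          (-(1 / m))).sub (Ad θ)
      refine monotoneOn_of_hasDerivWithinAt_nonneg (convex_Icc _ _)
        (fun x hx => (D x hx).continuousAt.continuousWithinAt)
        (fun x hx => (D x (interior_subset hx)).hasDerivWithinAt) ?_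
      intro x hx
      have hGR := Gge x (interior_subset hx)
      have hF := hR _ hGR
      have hw := hfG (r * sin x)
      have hP := hpp (r * sin x)
      simp only [y]
      set P := p (r * sin x)
      set g := G (r * sin x)
      have gpos : 0 < g := by linarith
      set v := r * cos x
      have e : -(1 / m) * (1 / (1 + (v / (m * g)) ^ 2) * ((r * (- sin x) * (m * g)
          - v * (m * (P * v))) / (m * g) ^ 2)) - P
          = P * (g * (f g - m ^ 2 * g)) / (m ^ 2 * g ^ 2 + v ^ 2) := by
        rw [show r * (- sin x) = - (P * f g) by rw [hw]; ring]
        have : m ^ 2 * g ^ 2 + v ^ 2 ≠ 0 := by positivity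
        have : (1 + (v / (m * g)) ^ 2) ≠ 0 := by positivity
        field_simp
        ring
      rw [e]
      have : 0 ≤ f g - m ^ 2 * g := by linarith
      positivity
    have := mono (Set.left_mem_Icc.2 hle) (Set.right_mem_Icc.2 hle) hle
    have B1 : B (π / 2) = 0 := by simp [B, y]
    have B2 : - (π / 2 / m) ≤ B θ1 := by
      simp only [B]
      have h3 := (arctan_lt_pi_div_two (y θ1)).le
      have h4 : 1 / m * arctan (y θ1) ≤ 1 / m * (π / 2) :=
        mul_le_mul_of_nonneg_left h3 (by positivity)
      have e : π / 2 / m = 1 / m * (π / 2) := by ring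
      rw [e]; linarith
    simp only [B1] at this
    linarith
  have e1 : π / 2 / m = ε / 4 := by rw [hm]; field_simp; ring
  have e2 : 2 * R / r ≤ ε / 4 := by
    rw [div_le_iff₀ hε] at hr2
    rw [div_le_div_iff₀ rpos (by norm_num)]
    linarith
  rw [sym]
  linarith

/-- Building the solution from the rotation. -/
lemma build (f G p : ℝ → ℝ) (hp : Continuous p) (hpp : ∀ w, 0 < p w) (hf0 : f 0 = 0)
    (hG : ∀ w, HasDerivAt G (p w) w) (hG0 : G 0 = 0) (hfG : ∀ w, p w * f (G w) = w)
    (k : ℕ) (r : ℝ) (hr : r ≠ 0) (ν : Bool) (hν : if ν then 0 < r else r < 0)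
    (hI : ∫ φ in (0:ℝ)..(k * π), p (r * sin φ) = 2) :
    ∃ u u' : ℝ → ℝ,
        (∀ x, HasDerivAt u (u' x) x) ∧
        (∀ x ∈ Set.Ioo (-1 : ℝ) 1, HasDerivAt u' (-(f (u x))) x) ∧
        u (-1) = 0 ∧ u 1 = 0 ∧ u ≠ 0 ∧ NodalT k ν u u' := by
  have Ac : Continuous fun φ : ℝ => p (r * sin φ) := by fun_prop
  let t : ℝ → ℝ := fun θ => ∫ φ in (0:ℝ)..θ, p (r * sin φ)
  have td : ∀ θ, HasDerivAt t (p (r * sin θ)) θ := fun θ =>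
    (Ac.integral_hasStrictDerivAt 0 θ).hasDerivAt
  obtain ⟨w1, -, hw1⟩ := (isCompact_Icc (a := -|r|) (b := |r|)).exists_isMinOn
    ⟨0, by simp⟩ hp.continuousOn
  set c := p w1 with hc
  have cpos : 0 < c := hpp w1
  have cle : ∀ φ, c ≤ p (r * sin φ) := by
    intro φ
    apply hw1
    rw [Set.mem_Icc, ← abs_le, abs_mul]
    exact mul_le_of_le_one_right (abs_nonneg _) (abs_sin_le_one _)
  have t0 : t 0 = 0 := by simp [t]
  have mono : Monotone (fun θ => t θ - c * θ) := by
    have D : ∀ θ, HasDerivAt (fun θ => t θ - c * θ) (p (r * sin θ) - c * 1) θ := fun θ =>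
      (td θ).sub ((hasDerivAt_id θ).const_mul c)
    exact monotone_of_hasDerivAt_nonneg D fun x => by
      have := cle x
      simp only [Pi.zero_apply]; linarith
  obtain ⟨Θ, hΘ1, hΘ2, hΘm, -, hΘd⟩ := exists_inv t _ td (fun θ => hpp _) c cpos
    (fun x hx => by have := mono hx; simp only [t0] at this; linarith)
    (fun x hx => by have := mono hx; simp only [t0] at this; linarith)
  have Θ0 : Θ 0 = 0 := by simpa [t0] using hΘ2 0
  have tk : t (k * π) = 2 := hI
  have Θ2 : Θ 2 = k * π := by rw [← tk, hΘ2]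
  have tm : StrictMono t := strictMono_of_hasDerivAt_pos td (fun θ => hpp _)
  have Θd : ∀ x, HasDerivAt (fun x => Θ (x + 1)) (p (r * sin (Θ (x + 1))))⁻¹ x := fun x =>
    (hΘd (x + 1)).comp_add_const x 1
  have ud : ∀ x, HasDerivAt (fun x => G (r * sin (Θ (x + 1)))) (r * cos (Θ (x + 1))) x := by
    intro x
    have := (hG (r * sin (Θ (x + 1)))).comp x (((Θd x).sin).const_mul r)
    refine this.congr_deriv ?_
    have := (hpp (r * sin (Θ (x + 1)))).ne'
    field_simp
  have u'd : ∀ x, HasDerivAt (fun x => r * cos (Θ (x + 1))) (-(f (G (r * sin (Θ (x + 1)))))) x := by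
    intro x
    have := ((Θd x).cos).const_mul r
    refine this.congr_deriv ?_
    have h1 := (hpp (r * sin (Θ (x + 1)))).ne'
    have h2 := hfG (r * sin (Θ (x + 1)))
    field_simp
    linarith
  have um1 : r * cos (Θ (-1 + 1)) = r := by simp [Θ0]
  refine ⟨fun x => G (r * sin (Θ (x + 1))), fun x => r * cos (Θ (x + 1)), ud, fun x _ => u'd x,
    ?_, ?_, ?_, ?_, ?_, ?_, ?_⟩
  · simp [Θ0, hG0]
  · norm_num [Θ2, hG0]
  · intro h
    have h1 := ud (-1)
    rw [h, um1] at h1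
    exact hr (h1.unique (hasDerivAt_const (-1 : ℝ) (0 : ℝ)))
  · simp only [um1]; exact hr
  · norm_num [Θ2, hr, cos_nat_mul_pi]
  · simp only [um1]; exact hν
  · let z : ℕ → ℝ := fun j => t (π / 2 + j * π) - 1
    have zΘ : ∀ j, Θ (z j + 1) = π / 2 + j * π := fun j => by simp [z, hΘ2]
    have zm : StrictMono z := by
      intro i j hij
      simp only [z, sub_lt_sub_iff_right]
      apply tm
      have : (i : ℝ) < j := by exact_mod_cast hij
      nlinarith [pi_pos]
    have zcos : ∀ j, cos (Θ (z j + 1)) = 0 := fun j => by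
      rw [zΘ, add_comm, cos_add_pi_div_two, sin_nat_mul_pi, neg_zero]
    refine ⟨(Finset.range k).image z, ?_, ?_, ?_, ?_, ?_⟩
    · rw [Finset.card_image_of_injective _ zm.injective, Finset.card_range]
    · intro x hx
      simp only [Finset.coe_image, Set.mem_image, Finset.coe_range, Set.mem_Iio] at hx
      obtain ⟨j, hj, rfl⟩ := hx
      have hj' : (j : ℝ) + 1 ≤ k := by exact_mod_cast hj
      have h1 : t 0 < t (π / 2 + j * π) := tm (by positivity)
      have h2 : t (π / 2 + j * π) < t (k * π) := tm (by nlinarith [pi_pos])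
      rw [t0] at h1
      rw [tk] at h2
      constructor <;> simp only [z] <;> linarith
    · intro x hx
      simp only [Finset.mem_image, Finset.mem_range]
      constructor
      · intro h
        have hcos : cos (Θ (x + 1)) = 0 := by simpa [hr] using h
        obtain ⟨n, hn⟩ := Real.cos_eq_zero_iff.1 hcos
        have h1 : Θ 0 < Θ (x + 1) := hΘm (by linarith [hx.1])
        have h2 : Θ (x + 1) < Θ 2 := hΘm (by linarith [hx.2])
        rw [Θ0, hn] at h1
        rw [Θ2, hn] at h2
        have n0 : 0 ≤ n := by
          by_contra hneg
          have : (n : ℝ) ≤ -1 := by exact_mod_cast (by omega : n ≤ -1)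
          nlinarith [pi_pos]
        obtain ⟨j, rfl⟩ := Int.eq_ofNat_of_zero_le n0
        refine ⟨j, ?_, ?_⟩
        · by_contra hneg
          have : (k : ℝ) ≤ j := by exact_mod_cast (by omega : k ≤ j)
          push_cast at h2
          nlinarith [pi_pos]
        · simp only [z]
          have : π / 2 + (j : ℝ) * π = Θ (x + 1) := by rw [hn]; push_cast; ring
          rw [this, hΘ1]; ring
      · rintro ⟨j, -, rfl⟩
        rw [zcos, mul_zero]
    · intro x hx
      obtain ⟨j, -, rfl⟩ := Finset.mem_image.1 hx
      rw [(u'd (z j)).deriv]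
      intro h
      have h2 := hfG (r * sin (Θ (z j + 1)))
      rw [neg_eq_zero.1 h, mul_zero] at h2
      have h3 : sin (Θ (z j + 1)) = 0 := by
        rcases mul_eq_zero.1 h2.symm with h | h
        · exact absurd h hr
        · exact h
      have := sin_sq_add_cos_sq (Θ (z j + 1))
      rw [h3, zcos] at this
      norm_num at this
    · intro x hx y hy hxy _
      obtain ⟨i, -, rfl⟩ := Finset.mem_image.1 hx
      obtain ⟨j, -, rfl⟩ := Finset.mem_image.1 hy
      have hij : i < j := zm.lt_iff_lt.1 hxy
      have hij' : (i : ℝ) + 1 ≤ j := by exact_mod_cast hij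
      refine ⟨t (((i + 1 : ℕ) : ℝ) * π) - 1, ⟨?_, ?_⟩, ?_⟩
      · simp only [z, sub_lt_sub_iff_right]
        apply tm
        push_cast
        nlinarith [pi_pos]
      · simp only [z, sub_lt_sub_iff_right]
        apply tm
        push_cast
        nlinarith [pi_pos]
      · simp only [sub_add_cancel, hΘ2, sin_nat_mul_pi, mul_zero, hG0]

/-- superlinear nodal solutions, Dirichlet case: if f is
superlinear at ±∞, f(0) = 0, f₀ = lim_{s→0} f(s)/s > 0, s f(s) > 0 for s ≠ 0,
and λ_{k₀}/f₀ > 1 with λ_k = (kπ/2)², then for each k ≥ k₀ and each sign ν the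
problem -u'' = f(u), u(±1) = 0 has a solution in T_{k,ν}. -/
theorem stmt_19 (f : ℝ → ℝ) (hf : Continuous f) (hf0 : f 0 = 0)
    (f₀ : ℝ) (hf₀pos : 0 < f₀)
    (hlim0 : Tendsto (fun s => f s / s) (nhdsWithin 0 {(0 : ℝ)}ᶜ) (nhds f₀))
    (hlimP : Tendsto (fun s => f s / s) atTop atTop)
    (hlimM : Tendsto (fun s => f s / s) atBot atTop)
    (hsf : ∀ s : ℝ, s ≠ 0 → 0 < s * f s)
    (k₀ : ℕ) (hk₀ : 1 ≤ k₀)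
    (hev : 1 < ((k₀ : ℝ) * π / 2) ^ 2 / f₀) :
    ∀ k : ℕ, k₀ ≤ k → ∀ ν : Bool,
      ∃ u u' : ℝ → ℝ,
        (∀ x, HasDerivAt u (u' x) x) ∧
        (∀ x ∈ Set.Ioo (-1 : ℝ) 1, HasDerivAt u' (-(f (u x))) x) ∧
        u (-1) = 0 ∧ u 1 = 0 ∧ u ≠ 0 ∧ NodalT k ν u u' := by
  intro k hk ν
  obtain ⟨G, p, hp, hpp, hG, hG0, hfG, hp0, hsurj⟩ :=
    exists_change f hf hf0 f₀ hf₀pos hlim0 hlimP hlimM hsf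
  let I : ℝ → ℝ := fun r => ∫ φ in (0:ℝ)..(k * π), p (r * sin φ)
  have Ic : Continuous I := by
    apply intervalIntegral.continuous_parametric_intervalIntegral_of_continuous'
    fun_prop
  have kpos : (0 : ℝ) < k := by exact_mod_cast (by omega : 0 < k)
  have I0 : 2 < I 0 := by
    simp only [I, zero_mul, hp0, intervalIntegral.integral_const, smul_eq_mul, sub_zero]
    rw [← div_eq_mul_inv, lt_div_iff₀ (Real.sqrt_pos.2 hf₀pos)]
    rw [lt_div_iff₀ hf₀pos, one_mul] at hev
    have h1 : √f₀ < (k₀ : ℝ) * π / 2 := by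
      rw [Real.sqrt_lt' (by positivity)]
      exact hev
    have h2 : (k₀ : ℝ) * π ≤ k * π :=
      mul_le_mul_of_nonneg_right (by exact_mod_cast hk) pi_pos.le
    linarith
  have hε : 0 < 1 / (2 * (k : ℝ)) := by positivity
  have E1 := half_wave f G p hp hpp hG hG0 hfG hsurj hlimP _ hε
  have E2 := half_wave (fun s => - f (-s)) (fun w => - G (-w)) (fun w => p (-w)) (by fun_prop)
    (fun w => hpp _)
    (fun w => by
      have := ((hG (-w)).comp w (hasDerivAt_neg w)).neg
      exact this.congr_deriv (by ring))
    (by simp [hG0]) (fun w => by have := hfG (-w); simp only [neg_neg]; linarith)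
    (fun s => by
      obtain ⟨w, hw⟩ := hsurj (-s)
      exact ⟨-w, by simp [hw]⟩)
    (by
      refine (hlimM.comp tendsto_neg_atTop_atBot).congr fun s => ?_
      simp only [Function.comp, div_neg, neg_div])
    _ hε
  obtain ⟨r, ⟨h1, h2⟩, rpos⟩ := ((E1.and E2).and (eventually_gt_atTop 0)).exists
  have key : ∀ ρ : ℝ, I ρ ≤ k * ((∫ φ in (0:ℝ)..π, p (ρ * sin φ))
      + ∫ φ in (0:ℝ)..π, p (-(ρ * sin φ))) := by
    intro ρ
    have Ac : Continuous fun φ : ℝ => p (ρ * sin φ) := by fun_prop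
    have per : Function.Periodic (fun φ : ℝ => p (ρ * sin φ)) (2 * π) := fun φ => by
      simp only [sin_add_two_pi]
    have a1 : I ρ ≤ ∫ φ in (0:ℝ)..(k * (2 * π)), p (ρ * sin φ) := by
      apply intervalIntegral.integral_mono_interval le_rfl (by positivity)
        (by nlinarith [pi_pos])
      · exact Eventually.of_forall fun x => (hpp _).le
      · exact Ac.intervalIntegrable _ _
    have a2 := per.intervalIntegral_add_zsmul_eq k 0
      (fun a b => Ac.intervalIntegrable a b)
    simp only [zero_add, zsmul_eq_mul, Int.cast_natCast] at a2
    have a3 := intervalIntegral.integral_add_adjacent_intervals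
      (Ac.intervalIntegrable 0 π) (Ac.intervalIntegrable π (2 * π)) (μ := MeasureTheory.volume)
    have a4 := intervalIntegral.integral_comp_add_right (a := 0) (b := π)
      (fun φ : ℝ => p (ρ * sin φ)) π
    simp only [sin_add_pi, mul_neg, zero_add] at a4
    rw [show π + π = 2 * π by ring] at a4
    rw [a2, ← a3, ← a4] at a1
    exact a1
  have bd : (k : ℝ) * (1 / (2 * k) + 1 / (2 * k)) = 1 := by field_simp; norm_num
  have Ir : I r < 2 := by
    have := key r
    have := mul_le_mul_of_nonneg_left (add_le_add h1 h2) kpos.le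
    linarith
  have Imr : I (-r) < 2 := by
    have h3 := key (-r)
    simp only [neg_mul, neg_neg] at h3
    have := mul_le_mul_of_nonneg_left (add_le_add h2 h1) kpos.le
    linarith
  obtain ⟨ρ, hρ, hν⟩ : ∃ ρ, I ρ = 2 ∧ (if ν then 0 < ρ else ρ < 0) := by
    cases ν with
    | true =>
      obtain ⟨ρ, hρ, h⟩ := intermediate_value_Icc' rpos.le Ic.continuousOn ⟨Ir.le, I0.le⟩
      refine ⟨ρ, h, ?_⟩
      simp only [if_true]
      refine lt_of_le_of_ne hρ.1 ?_
      rintro rfl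
      linarith
    | false =>
      obtain ⟨ρ, hρ, h⟩ := intermediate_value_Icc (by linarith : -r ≤ 0) Ic.continuousOn
        ⟨Imr.le, I0.le⟩
      refine ⟨ρ, h, ?_⟩
      simp only [Bool.false_eq_true, if_false]
      refine lt_of_le_of_ne hρ.2 ?_
      rintro rfl
      linarith
  have ρ0 : ρ ≠ 0 := by
    rintro rfl
    linarith
  exact build f G p hp hpp hf0 hG hG0 hfG k ρ ρ0 ν hν hρ
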